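/- Let G be a finitely generated group with a finite-index normal subgroup H such that the single twisted equation problem in H is decidable. Then the single equation problem in G is decidable. -/

import Mathlib

/-- Evaluation of a word over a generating set `S` (letters: generator index and sign). -/
def genWordEval {G : Type*} [Group G] {k : ℕ} (S : Fin k → G)
    (w : List (Fin k × Bool)) : G :=
  (w.map fun l => if l.2 then S l.1 else (S l.1)⁻¹).prod

/-- Evaluation of a word in the free group on variables `ℕ` under an assignment `φ`. -/
def varWordEval {G : Type*} [Group G] (φ : ℕ → G) (u : List (ℕ × Bool)) : G :=
  (u.map fun l => if l.2 then φ l.1 else (φ l.1)⁻¹).prod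

/-- Evaluation of an (untwisted) equation word: letters are either constants
(generator index and sign) or variables (variable index and sign). -/
def eqnEval {G : Type*} [Group G] {k : ℕ} (S : Fin k → G) (φ : ℕ → G)
    (w : List ((Fin k × Bool) ⊕ (ℕ × Bool))) : G :=
  (w.map fun l => match l with
    | Sum.inl (i, s) => if s then S i else (S i)⁻¹
    | Sum.inr (v, s) => if s then φ v else (φ v)⁻¹).prod

/-- A letter of a twisted equation: either a constant (generator index and sign), or a
pair consisting of a word in the variables together with a code for an automorphism
(its action on the generators, given as words over the generators). -/
abbrev TwistedLetter (k : ℕ) :=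
  (Fin k × Bool) ⊕ (List (ℕ × Bool) × List (List (Fin k × Bool)))

/-- A twisted equation, represented as a word in twisted letters. -/
abbrev TwistedEqn (k : ℕ) := List (TwistedLetter k)

/-- `code` represents the automorphism `ψ`: its `j`-th entry is a word over the
generators representing `ψ (S j)`. -/
def EncodesAut {G : Type*} [Group G] {k : ℕ} (S : Fin k → G)
    (code : List (List (Fin k × Bool))) (ψ : G ≃* G) : Prop :=
  code.length = k ∧ ∀ j : Fin k, genWordEval S (code.getD j []) = ψ (S j)

/-- A twisted equation is valid if each automorphism code occurring in it really
encodes an automorphism of `G`. -/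
def TwistedValid {G : Type*} [Group G] {k : ℕ} (S : Fin k → G) (w : TwistedEqn k) : Prop :=
  ∀ l ∈ w, ∀ u code, l = Sum.inr (u, code) → ∃ ψ : G ≃* G, EncodesAut S code ψ

/-- A twisted equation admits a solution. -/
def TwistedHasSolution {G : Type*} [Group G] {k : ℕ} (S : Fin k → G)
    (w : TwistedEqn k) : Prop :=
  ∃ φ : ℕ → G, ∃ vals : List G,
    List.Forall₂ (fun (l : TwistedLetter k) (v : G) =>
      match l with
      | Sum.inl (i, s) => v = if s then S i else (S i)⁻¹
      | Sum.inr (u, code) =>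
          ∃ ψ : G ≃* G, EncodesAut S code ψ ∧ v = ψ (varWordEval φ u)) w vals ∧
    vals.prod = 1

/-- The value `v` of a single letter of a twisted equation under the assignment `φ`. -/
def TwistedLetterEval {G : Type*} [Group G] {k : ℕ} (S : Fin k → G) (φ : ℕ → G)
    (l : TwistedLetter k) (v : G) : Prop :=
  match l with
  | Sum.inl (i, s) => v = if s then S i else (S i)⁻¹
  | Sum.inr (u, code) => ∃ ψ : G ≃* G, EncodesAut S code ψ ∧ v = ψ (varWordEval φ u)

/-- The word `w` is well formed and takes the value `g` under the assignment `φ`. -/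
def TwistedEval {G : Type*} [Group G] {k : ℕ} (S : Fin k → G) (φ : ℕ → G)
    (w : TwistedEqn k) (g : G) : Prop :=
  ∃ vals : List G, List.Forall₂ (TwistedLetterEval S φ) w vals ∧ vals.prod = g

theorem twistedHasSolution_iff {G : Type*} [Group G] {k : ℕ} {S : Fin k → G}
    {w : TwistedEqn k} : TwistedHasSolution S w ↔ ∃ φ, TwistedEval S φ w 1 :=
  Iff.rfl

/-- An automorphism is determined by any of its codes over a generating family. -/
theorem EncodesAut.unique {G : Type*} [Group G] {k : ℕ} {S : Fin k → G}
    (hS : Subgroup.closure (Set.range S) = ⊤) {code : List (List (Fin k × Bool))}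
    {ψ ψ' : G ≃* G} (h : EncodesAut S code ψ) (h' : EncodesAut S code ψ') : ψ = ψ' := by
  have : ψ.toMonoidHom = ψ'.toMonoidHom := by
    refine MonoidHom.eq_of_eqOn_dense hS ?_
    rintro _ ⟨j, rfl⟩
    exact (h.2 j).symm.trans (h'.2 j)
  exact MulEquiv.ext fun x => DFunLike.congr_fun this x

namespace TwistedEval

variable {G : Type*} [Group G] {k : ℕ} {S : Fin k → G} {φ : ℕ → G}

theorem nil : TwistedEval S φ [] 1 := ⟨[], .nil, rfl⟩

theorem append {w w' : TwistedEqn k} {g g' : G} (h : TwistedEval S φ w g)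
    (h' : TwistedEval S φ w' g') : TwistedEval S φ (w ++ w') (g * g') := by
  obtain ⟨vals, hv, rfl⟩ := h
  obtain ⟨vals', hv', rfl⟩ := h'
  exact ⟨vals ++ vals', List.rel_append hv hv', List.prod_append⟩

theorem cons {l : TwistedLetter k} {w : TwistedEqn k} {g g' : G}
    (h : TwistedLetterEval S φ l g) (h' : TwistedEval S φ w g') :
    TwistedEval S φ (l :: w) (g * g') := by
  obtain ⟨vals, hv, rfl⟩ := h'
  exact ⟨g :: vals, .cons h hv, List.prod_cons⟩

theorem unique (hS : Subgroup.closure (Set.range S) = ⊤) {w : TwistedEqn k} {g g' : G}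
    (h : TwistedEval S φ w g) (h' : TwistedEval S φ w g') : g = g' := by
  obtain ⟨vals, hv, rfl⟩ := h
  obtain ⟨vals', hv', rfl⟩ := h'
  have hR : Relator.RightUnique (TwistedLetterEval S φ) := by
    rintro (⟨i, s⟩ | ⟨u, code⟩) v v' hv hv'
    · exact Eq.trans hv hv'.symm
    · obtain ⟨ψ, hψ, rfl⟩ := hv
      obtain ⟨ψ', hψ', rfl⟩ := hv'
      rw [hψ.unique hS hψ']
  rw [hR.forall₂ hv hv']

theorem twistedValid {w : TwistedEqn k} {g : G} (h : TwistedEval S φ w g) :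
    TwistedValid S w := by
  obtain ⟨vals, hv, -⟩ := h
  rintro l hl u code rfl
  induction hv with
  | nil => simp at hl
  | cons hlv _ ih =>
    rcases List.mem_cons.1 hl with rfl | hl
    · obtain ⟨ψ, hψ, -⟩ := hlv
      exact ⟨ψ, hψ⟩
    · exact ih hl

theorem genWord (w : List (Fin k × Bool)) :
    TwistedEval S φ (w.map Sum.inl) (genWordEval S w) := by
  induction w with
  | nil => exact nil
  | cons l w ih => exact cons (l := Sum.inl l) rfl ih

end TwistedEval

theorem exists_genWordEval_eq {G : Type*} [Group G] {k : ℕ} {S : Fin k → G}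
    (hS : Subgroup.closure (Set.range S) = ⊤) (g : G) : ∃ w, genWordEval S w = g := by
  have hg : g ∈ Subgroup.closure (Set.range S) := hS ▸ Subgroup.mem_top g
  induction hg using Subgroup.closure_induction'' with
  | mem x hx =>
    obtain ⟨j, rfl⟩ := hx
    exact ⟨[(j, true)], by simp [genWordEval]⟩
  | inv_mem x hx =>
    obtain ⟨j, rfl⟩ := hx
    exact ⟨[(j, false)], by simp [genWordEval]⟩
  | one => exact ⟨[], rfl⟩
  | mul x y _ _ hx hy =>
    obtain ⟨w, rfl⟩ := hx
    obtain ⟨w', rfl⟩ := hy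
    exact ⟨w ++ w', by simp [genWordEval]⟩

theorem exists_twistedEval_const {G : Type*} [Group G] {k : ℕ} {S : Fin k → G}
    (hS : Subgroup.closure (Set.range S) = ⊤) (g : G) :
    ∃ w : TwistedEqn k, ∀ φ, TwistedEval S φ w g := by
  obtain ⟨w, rfl⟩ := exists_genWordEval_eq hS g
  exact ⟨w.map Sum.inl, fun _ => .genWord w⟩

theorem exists_encodesAut {G : Type*} [Group G] {k : ℕ} {S : Fin k → G}
    (hS : Subgroup.closure (Set.range S) = ⊤) (ψ : G ≃* G) : ∃ code, EncodesAut S code ψ := by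
  choose W hW using exists_genWordEval_eq hS
  refine ⟨List.ofFn fun j => W (ψ (S j)), List.length_ofFn, fun j => ?_⟩
  rw [List.getD_eq_getElem _ _ (by simp), List.getElem_ofFn, hW]

/-- Base-`n` digit `v` of `m`: each finite assignment of elements of `Fin n` to variables is
`natDigit n m` for some `m`. -/
def natDigit (n : ℕ) [NeZero n] (m v : ℕ) : Fin n := Fin.ofNat n (m / n ^ v)

theorem exists_natDigit_eq (n : ℕ) [NeZero n] (N : ℕ) (ρ : ℕ → Fin n) :
    ∃ m < n ^ N, ∀ v < N, natDigit n m v = ρ v := by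
  induction N generalizing ρ with
  | zero => exact ⟨0, by simp, by simp⟩
  | succ N ih =>
    obtain ⟨m, hm, h⟩ := ih fun v => ρ (v + 1)
    have hn : 0 < n := Nat.pos_of_ne_zero (NeZero.ne n)
    refine ⟨ρ 0 + n * m, ?_, ?_⟩
    · calc (ρ 0 : ℕ) + n * m < n * (m + 1) := by have := (ρ 0).isLt; rw [mul_add]; omega
        _ ≤ n * n ^ N := Nat.mul_le_mul_left _ hm
        _ = n ^ (N + 1) := by rw [pow_succ, mul_comm]
    · rintro (_ | v) hv
      · apply Fin.ext
        simp [natDigit, Fin.ofNat, Nat.mod_eq_of_lt (ρ 0).isLt]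
      · rw [← h v (by omega), natDigit, natDigit, pow_succ', ← Nat.div_div_eq_div_mul,
          Nat.add_mul_div_left _ _ hn, Nat.div_eq_of_lt (ρ 0).isLt, zero_add]

/-- The words in constants and variables that are the left-hand sides of equations. -/
abbrev EqnWord (k : ℕ) := List ((Fin k × Bool) ⊕ (ℕ × Bool))

/-- A strict upper bound for the indices of the variables of an equation. -/
def varBound {k : ℕ} (w : EqnWord k) : ℕ :=
  w.foldr (fun l b => l.elim (fun _ => 0) (fun p => p.1 + 1) + b) 0

theorem eqnEval_congr {G : Type*} [Group G] {k : ℕ} (S : Fin k → G) {φ φ' : ℕ → G}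
    (w : EqnWord k) (h : ∀ v < varBound w, φ v = φ' v) :
    eqnEval S φ w = eqnEval S φ' w := by
  induction w with
  | nil => rfl
  | cons l w ih =>
    have hw := ih fun v hv => h v (by simp only [varBound, List.foldr_cons] at hv ⊢; omega)
    simp only [eqnEval, List.map_cons, List.prod_cons] at hw ⊢
    rw [hw]
    rcases l with ⟨i, s⟩ | ⟨v, s⟩
    · rfl
    · have := h v (by simp only [varBound, List.foldr_cons, Sum.elim_inr]; omega)
      simp only [this]

/-- The finite tables driving the translation of equations over a group into twisted equations
over a subgroup with `n` cosets. The first component treats a constant read in a given coset,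
the second a variable whose value lies in a given coset; each yields a word to be
output and the next coset. -/
abbrev CosetTables (k k' n : ℕ) :=
  (Fin n × (Fin k × Bool) → TwistedEqn k' × Fin n) ×
  (Fin n × Fin n × Bool →
    TwistedEqn k' × List (List (Fin k' × Bool)) × TwistedEqn k' × Fin n)

/-- Process one letter of an equation. -/
def translateStep {k k' n : ℕ} [NeZero n] (T : CosetTables k k' n) (m : ℕ)
    (st : Fin n × TwistedEqn k') (l : (Fin k × Bool) ⊕ (ℕ × Bool)) : Fin n × TwistedEqn k' :=
  l.casesOn (fun c => ((T.1 (st.1, c)).2, st.2 ++ (T.1 (st.1, c)).1))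
    (fun p =>
      let d := T.2 (st.1, natDigit n m p.1, p.2)
      (d.2.2.2, st.2 ++ (d.1 ++ Sum.inr ([p], d.2.1) :: d.2.2.1)))

/-- Process an equation, where `m` codes the cosets of the values of the variables. -/
def translateEqn {k k' n : ℕ} [NeZero n] (T : CosetTables k k' n) (st : Fin n × TwistedEqn k')
    (w : EqnWord k) (m : ℕ) : Fin n × TwistedEqn k' :=
  w.foldl (translateStep T m) st

theorem primrec_nat_pow : Primrec₂ ((· ^ ·) : ℕ → ℕ → ℕ) :=
  Primrec₂.unpaired'.1 Nat.Primrec.pow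

theorem primrec_natDigit (n : ℕ) [NeZero n] : Primrec₂ (natDigit n) := by
  refine Primrec.fin_val_iff.1 ?_
  exact Primrec.nat_mod.comp
    (Primrec.nat_div.comp Primrec.fst (primrec_nat_pow.comp (Primrec.const n) Primrec.snd))
    (Primrec.const n)

theorem primrec_varBound {k : ℕ} : Primrec (varBound (k := k)) := by
  have hl : Primrec fun l : (Fin k × Bool) ⊕ (ℕ × Bool) =>
      l.elim (fun _ => 0) (fun p => p.1 + 1) :=
    (Primrec.sumCasesOn Primrec.id (Primrec.const 0).to₂
      (Primrec.succ.comp (Primrec.fst.comp Primrec.snd)).to₂).of_eq (by rintro (_ | _) <;> rfl)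
  exact Primrec.list_foldr (f := id) (g := fun _ => 0)
    (h := fun _ (x : ((Fin k × Bool) ⊕ (ℕ × Bool)) × ℕ) =>
      x.1.elim (fun _ => 0) (fun p => p.1 + 1) + x.2)
    Primrec.id (Primrec.const 0) (Primrec.nat_add.comp
      (hl.comp (Primrec.fst.comp Primrec.snd)) (Primrec.snd.comp Primrec.snd)).to₂

theorem primrec_translateStep {k k' n : ℕ} [NeZero n] (T : CosetTables k k' n) :
    Primrec fun x : ℕ × (Fin n × TwistedEqn k') × ((Fin k × Bool) ⊕ (ℕ × Bool)) =>
      translateStep T x.1 x.2.1 x.2.2 := by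
  let α := ℕ × (Fin n × TwistedEqn k') × ((Fin k × Bool) ⊕ (ℕ × Bool))
  have hq {β : Type} [Primcodable β] : Primrec fun y : α × β => y.1.2.1.1 :=
    Primrec.fst.comp (Primrec.fst.comp (Primrec.snd.comp Primrec.fst))
  have hout {β : Type} [Primcodable β] : Primrec fun y : α × β => y.1.2.1.2 :=
    Primrec.snd.comp (Primrec.fst.comp (Primrec.snd.comp Primrec.fst))
  have hm : Primrec fun y : α × (ℕ × Bool) => y.1.1 := Primrec.fst.comp Primrec.fst
  have hT₁ : Primrec fun y : α × (Fin k × Bool) => T.1 (y.1.2.1.1, y.2) :=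
    (Primrec.dom_finite T.1).comp (Primrec.pair hq Primrec.snd)
  have hT₂ : Primrec fun y : α × (ℕ × Bool) =>
      T.2 (y.1.2.1.1, natDigit n y.1.1 y.2.1, y.2.2) :=
    (Primrec.dom_finite T.2).comp (Primrec.pair hq (Primrec.pair
      ((primrec_natDigit n).comp hm (Primrec.fst.comp Primrec.snd))
      (Primrec.snd.comp Primrec.snd)))
  have hcode := Primrec.snd.comp hT₂
  have hpost := Primrec.snd.comp hcode
  have hvar : Primrec fun y : α × (ℕ × Bool) => [y.2] :=
    Primrec.list_cons.comp Primrec.snd (Primrec.const [])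
  have hletter : Primrec fun y : α × (ℕ × Bool) =>
      (Sum.inr ([y.2], (T.2 (y.1.2.1.1, natDigit n y.1.1 y.2.1, y.2.2)).2.1) :
        TwistedLetter k') :=
    Primrec.sumInr.comp (Primrec.pair hvar (Primrec.fst.comp hcode))
  exact Primrec.sumCasesOn (Primrec.snd.comp Primrec.snd)
    (Primrec.pair (Primrec.snd.comp hT₁)
      (Primrec.list_append.comp hout (Primrec.fst.comp hT₁))).to₂
    (Primrec.pair (Primrec.snd.comp hpost)
      (Primrec.list_append.comp hout (Primrec.list_append.comp (Primrec.fst.comp hT₂)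
        (Primrec.list_cons.comp hletter (Primrec.fst.comp hpost))))).to₂

theorem primrec_translateEqn {k k' n : ℕ} [NeZero n] (T : CosetTables k k' n)
    (st : Fin n × TwistedEqn k') : Primrec₂ (translateEqn (k := k) T st) :=
  Primrec.list_foldl (f := fun x : EqnWord k × ℕ => x.1) (g := fun _ => st)
    (h := fun x y => translateStep T x.2 y.1 y.2) Primrec.fst (Primrec.const st)
    ((primrec_translateStep T).comp (Primrec.pair (Primrec.snd.comp Primrec.fst) Primrec.snd)).to₂

/-- Bounded search preserves computability. -/
theorem Computable.exists_bool_lt {α : Type*} [Primcodable α] {f : α → ℕ} {p : α → ℕ → Bool}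
    (hf : Computable f) (hp : Computable₂ p) :
    ∃ d : α → Bool, Computable d ∧ ∀ a, d a = true ↔ ∃ m < f a, p a m = true := by
  refine ⟨fun a => Nat.rec false (fun m b => b || p a m) (f a), ?_, fun a => ?_⟩
  · refine Computable.nat_rec (h := fun a x => x.2 || p a x.1) hf (Computable.const false) ?_
    exact (Primrec.or.to_comp.comp (Computable.snd.comp Computable.snd)
      (hp.comp Computable.fst (Computable.fst.comp Computable.snd))).to₂
  · beta_reduce
    induction f a with
    | zero => simp
    | succ N ih =>
      simp only [Bool.or_eq_true, ih, Nat.lt_succ_iff_lt_or_eq, or_and_right, exists_or,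
        exists_eq_left]

section Translation

variable {G : Type*} [Group G] {k k' n : ℕ} {S : Fin k → G} {H : Subgroup G}
  {S' : Fin k' → ↥H}

/-- The tables `T` are correct for the coset representatives `t`. -/
def CosetTables.Correct (S : Fin k → G) (S' : Fin k' → ↥H) (t : Fin n → G)
    (T : CosetTables k k' n) : Prop :=
  (∀ q i s, ∀ χ : ℕ → H, ∃ c : H, TwistedEval S' χ (T.1 (q, i, s)).1 c ∧
    t q * (if s then S i else (S i)⁻¹) = c * t (T.1 (q, i, s)).2) ∧
  ∀ q r s, ∀ χ : ℕ → H, ∀ v, ∃ c : H,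
    TwistedEval S' χ ((T.2 (q, r, s)).1 ++
      Sum.inr ([(v, s)], (T.2 (q, r, s)).2.1) :: (T.2 (q, r, s)).2.2.1) c ∧
    t q * (if s then χ v * t r else (χ v * t r)⁻¹) = c * t (T.2 (q, r, s)).2.2.2

theorem CosetTables.exists_correct [H.Normal] (S : Fin k → G)
    (hS' : Subgroup.closure (Set.range S') = ⊤) {t : Fin n → G}
    (ht : ∀ g, ∃ q, g * (t q)⁻¹ ∈ H) : ∃ T : CosetTables k k' n, T.Correct S S' t := by
  choose rep hrep using ht
  choose word hword using exists_twistedEval_const hS'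
  choose code hcode using exists_encodesAut hS'
  let lift (g : G) : H := ⟨g * (t (rep g))⁻¹, hrep g⟩
  refine ⟨(fun p => (word (lift (t p.1 * if p.2.2 then S p.2.1 else (S p.2.1)⁻¹)),
      rep (t p.1 * if p.2.2 then S p.2.1 else (S p.2.1)⁻¹)),
    fun p => if p.2.2
      then ([], code (MulAut.conjNormal (t p.1)), word (lift (t p.1 * t p.2.1)),
        rep (t p.1 * t p.2.1))
      else (word (lift (t p.1 * (t p.2.1)⁻¹)),
        code (MulAut.conjNormal (t (rep (t p.1 * (t p.2.1)⁻¹)))), [],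
        rep (t p.1 * (t p.2.1)⁻¹))), ?_, ?_⟩
  · intro q i s χ
    exact ⟨_, hword _ χ, by simp [lift]⟩
  · rintro q r (_ | _) χ v
    · refine ⟨_, (hword _ χ).append (.cons ⟨_, hcode _, rfl⟩ .nil), ?_⟩
      simp [lift, varWordEval, mul_assoc]
    · refine ⟨_, .append .nil (.cons ⟨_, hcode _, rfl⟩ (hword _ χ)), ?_⟩
      simp [lift, varWordEval, mul_assoc]

theorem CosetTables.Correct.translateEqn_eval [NeZero n] {t : Fin n → G} {T : CosetTables k k' n}
    (hT : T.Correct S S' t) (χ : ℕ → H) (m : ℕ) (w : EqnWord k) (st : Fin n × TwistedEqn k')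
    (g : H) (hst : TwistedEval S' χ st.2 g) :
    ∃ c : H, TwistedEval S' χ (translateEqn T st w m).2 c ∧
      g * t st.1 * eqnEval S (fun v => χ v * t (natDigit n m v)) w =
        c * t (translateEqn T st w m).1 := by
  induction w generalizing st g with
  | nil => exact ⟨g, hst, by simp [eqnEval, translateEqn]⟩
  | cons l w ih =>
    have key : ∃ c : H, TwistedEval S' χ (translateStep T m st l).2 (g * c) ∧
        t st.1 * eqnEval S (fun v => χ v * t (natDigit n m v)) [l] =
          c * t (translateStep T m st l).1 := by
      rcases l with ⟨i, s⟩ | ⟨v, s⟩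
      · obtain ⟨c, hc, h⟩ := hT.1 st.1 i s χ
        exact ⟨c, hst.append hc, by simpa [eqnEval, translateStep] using h⟩
      · obtain ⟨c, hc, h⟩ := hT.2 st.1 (natDigit n m v) s χ v
        exact ⟨c, hst.append hc, by simpa [eqnEval, translateStep] using h⟩
    obtain ⟨c, hc, h⟩ := key
    obtain ⟨d, hd, h'⟩ := ih _ _ hc
    refine ⟨d, hd, Eq.trans ?_ h'⟩
    rw [Subgroup.coe_mul, mul_assoc (g : G) (c : G), ← h]
    simp [eqnEval, mul_assoc]

end Translation

/-- If a finitely generated group `G` has a finite-index normal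
subgroup `H` (finitely generated, with generating set `S'`) in which the single
twisted equation problem is decidable, then the single equation problem in `G` is
decidable. -/
theorem singleEquationProblem_decidable_of_twisted_decidable_finiteIndex_normal
    {G : Type*} [Group G] {k : ℕ} (S : Fin k → G)
    (hS : Subgroup.closure (Set.range S) = ⊤)
    (H : Subgroup G) [H.Normal] (hidx : H.index ≠ 0)
    {k' : ℕ} (S' : Fin k' → ↥H)
    (hS' : Subgroup.closure (Set.range S') = ⊤)
    (hH : ∃ dec' : TwistedEqn k' → Bool,
      Computable dec' ∧
        ∀ w, TwistedValid S' w → (dec' w = true ↔ TwistedHasSolution S' w)) :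
    ∃ dec : List ((Fin k × Bool) ⊕ (ℕ × Bool)) → Bool,
      Computable dec ∧
        ∀ w, dec w = true ↔ ∃ φ : ℕ → G, eqnEval S φ w = 1 := by
  obtain ⟨dec', hdec', hdec⟩ := hH
  let n := H.index
  have : NeZero n := ⟨hidx⟩
  have : H.FiniteIndex := ⟨hidx⟩
  obtain ⟨t, ht⟩ : ∃ t : Fin n → G, ∀ g, ∃ q, g * (t q)⁻¹ ∈ H := by
    let e : G ⧸ H ≃ Fin n := Finite.equivFinOfCardEq rfl
    refine ⟨fun q => (e.symm q).out, fun g => ⟨e g, ?_⟩⟩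
    rw [← QuotientGroup.eq_one_iff]
    simp
  obtain ⟨T, hT⟩ := CosetTables.exists_correct S hS' ht
  choose word hword using exists_twistedEval_const hS'
  obtain ⟨q₀, hq₀⟩ := ht 1
  obtain ⟨u₀, hu₀⟩ := exists_twistedEval_const hS' ⟨_, hq₀⟩
  choose rep hrep using ht
  classical
  let last (q : Fin n) : H := if h : t q ∈ H then ⟨t q, h⟩ else 1
  let eqn (w : EqnWord k) (m : ℕ) : Fin n × TwistedEqn k' :=
    translateEqn T (q₀, u₀) w m
  have heqn : Computable₂ eqn := (primrec_translateEqn T _).to_comp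
  have eqn_eval (w : EqnWord k) (m : ℕ) (χ : ℕ → H) (hq : t (eqn w m).1 ∈ H) :
      ∃ c : H, TwistedEval S' χ ((eqn w m).2 ++ word (last (eqn w m).1)) c ∧
        eqnEval S (fun v => χ v * t (natDigit n m v)) w = c := by
    obtain ⟨c, hc, h⟩ := hT.translateEqn_eval χ m w (q₀, u₀) _ (hu₀ χ)
    refine ⟨_, hc.append (hword _ χ), ?_⟩
    simpa [last, hq, eqn] using h
  obtain ⟨dec, hcomp, hspec⟩ := Computable.exists_bool_lt (α := EqnWord k)
    (f := fun w => n ^ varBound w)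
    (p := fun w m => decide (t (eqn w m).1 ∈ H) &&
      dec' ((eqn w m).2 ++ word (last (eqn w m).1)))
    (primrec_nat_pow.comp (Primrec.const n) primrec_varBound).to_comp
    (Primrec.and.to_comp.comp
      ((Primrec.dom_finite fun q : Fin n => decide (t q ∈ H)).to_comp.comp
        (Computable.fst.comp heqn))
      (hdec'.comp (Computable.list_append.comp (Computable.snd.comp heqn)
        ((Primrec.dom_finite fun q => word (last q)).to_comp.comp (Computable.fst.comp heqn)))))
  refine ⟨dec, hcomp, fun w => (hspec w).trans ?_⟩
  simp only [Bool.and_eq_true, decide_eq_true_eq]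
  constructor
  · rintro ⟨m, -, hq, hd⟩
    obtain ⟨c₁, hc₁, -⟩ := eqn_eval w m 1 hq
    obtain ⟨χ, hχ⟩ := twistedHasSolution_iff.1 ((hdec _ hc₁.twistedValid).1 hd)
    obtain ⟨c, hc, h⟩ := eqn_eval w m χ hq
    exact ⟨_, by rw [h, hc.unique hS' hχ, Subgroup.coe_one]⟩
  · rintro ⟨φ, hφ⟩
    obtain ⟨m, hm, hdigit⟩ := exists_natDigit_eq n (varBound w) fun v => rep (φ v)
    let χ (v : ℕ) : H := ⟨φ v * (t (rep (φ v)))⁻¹, hrep _⟩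
    have hχ : eqnEval S (fun v => χ v * t (natDigit n m v)) w = 1 := by
      rw [← hφ]
      refine eqnEval_congr S w fun v hv => ?_
      simp [χ, hdigit v hv]
    obtain ⟨c, -, h⟩ := hT.translateEqn_eval χ m w (q₀, u₀) _ (hu₀ χ)
    have hq : t (eqn w m).1 ∈ H := by
      rw [hχ] at h
      simp only [one_mul, inv_mul_cancel] at h
      exact (H.mul_mem_cancel_left c.2).1 (h.subst (motive := (· ∈ H)) H.one_mem)
    obtain ⟨c, hc, h⟩ := eqn_eval w m χ hq
    obtain rfl : c = 1 := Subtype.ext (h.symm.trans hχ)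
    exact ⟨m, hm, hq, (hdec _ hc.twistedValid).2 (twistedHasSolution_iff.2 ⟨χ, hc⟩)⟩
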